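/- If (μ, ν) is a regular pair of standard Weyl pairs, then the canonical map Ω(μ,ν) : V_{(μ,ν)} ⊗ ℂ^N → ℂ^N ⊗ ℂ^N determined by Ω(f ⊗ w) = f(w) is a linear isomorphism. -/

import Mathlib

open TensorProduct

noncomputable section

/-- ℂ^N: functions from ℤ/Nℤ to ℂ. -/
abbrev CN (N : ℕ) := ZMod N → ℂ

/-- The operator A with A e_k = q^{2k} e_k. -/
def opA (q : ℂ) (N : ℕ) : Module.End ℂ (CN N) where
  toFun f := fun k => q ^ (2 * k.val) * f k
  map_add' f g := by funext k; simp [mul_add]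
  map_smul' c f := by funext k; simp [smul_eq_mul]; ring

/-- The operator B with B e_k = e_{k+1}. -/
def opB (N : ℕ) : Module.End ℂ (CN N) where
  toFun f := fun k => f (k - 1)
  map_add' f g := by funext k; simp
  map_smul' c f := by funext k; simp

/-- The operator C with C e_k = q^{1-2k} e_{k-1}, i.e. (C f)(k) = q^{-1-2k} f(k+1). -/
def opC (q : ℂ) (N : ℕ) : Module.End ℂ (CN N) where
  toFun f := fun k => q ^ (-1 - 2 * (k.val : ℤ)) * f (k + 1)
  map_add' f g := by funext k; simp [mul_add]
  map_smul' c f := by funext k; simp [smul_eq_mul]; ring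

/-- A Weyl pair: invertible endomorphisms with X Y = q² Y X. -/
def IsWeylPair (q : ℂ) {V : Type*} [AddCommMonoid V] [Module ℂ V]
    (X Y : Module.End ℂ V) : Prop :=
  IsUnit X ∧ IsUnit Y ∧ X * Y = q ^ 2 • (Y * X)

/-- A subspace invariant under both X and Y. -/
def WeylInvariant {V : Type*} [AddCommMonoid V] [Module ℂ V]
    (X Y : Module.End ℂ V) (W : Submodule ℂ V) : Prop :=
  (∀ v ∈ W, X v ∈ W) ∧ (∀ v ∈ W, Y v ∈ W)

/-- An irreducible Weyl pair. -/
def IsIrreducibleWeylPair (q : ℂ) {V : Type*} [AddCommMonoid V] [Module ℂ V]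
    (X Y : Module.End ℂ V) : Prop :=
  IsWeylPair q X Y ∧ Nontrivial V ∧
    ∀ W : Submodule ℂ V, WeylInvariant X Y W → W = ⊥ ∨ W = ⊤
/-- The Clebsch–Gordan space of a pair of Weyl pairs: all linear maps
f : ℂ^N → ℂ^N ⊗ ℂ^N with f∘X_{αβ} = (X_α⊗X_β)∘f and
f∘Y_{αβ} = (X_α⁻¹⊗Y_β + Y_α⊗Id)∘f. -/
def CGsub (N : ℕ) (Xa Ya Xb Yb Xab Yab : Module.End ℂ (CN N)) :
    Submodule ℂ (CN N →ₗ[ℂ] (CN N ⊗[ℂ] CN N)) where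
  carrier := {f | f ∘ₗ Xab = (TensorProduct.map Xa Xb) ∘ₗ f ∧
    f ∘ₗ Yab = (TensorProduct.map (Ring.inverse Xa) Yb + TensorProduct.map Ya 1) ∘ₗ f}
  add_mem' := by
    rintro f g ⟨hf1, hf2⟩ ⟨hg1, hg2⟩
    constructor <;> simp only [LinearMap.add_comp, LinearMap.comp_add, hf1, hf2, hg1, hg2]
  zero_mem' := by constructor <;> simp
  smul_mem' := by
    rintro c f ⟨hf1, hf2⟩
    constructor <;> simp only [LinearMap.smul_comp, LinearMap.comp_smul, hf1, hf2]


open Polynomial in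
lemma prodformula (N : ℕ) (hN : 1 ≤ N) (w : ℂ) (hw : IsPrimitiveRoot w N) (a : ℂ) :
    ∏ j ∈ Finset.range N, (C a + C (w ^ j) * (X : ℂ[X])) = C a ^ N - (-X) ^ N := by
  have : NeZero N := ⟨by omega⟩
  have hC : IsPrimitiveRoot (C w) N := hw.map_of_injective (f := (C : ℂ →+* ℂ[X])) C_injective
  rw [hC.pow_sub_pow_eq_prod_sub_mul (C a) (-X : ℂ[X]) (by omega)]
  symm
  refine Finset.prod_bij' (i := fun μ hμ => ((hC.eq_pow_of_pow_eq_one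
      ((mem_nthRootsFinset (by omega : 0 < N) 1).1 hμ)).choose))
      (j := fun j _ => (C w) ^ j) ?_ ?_ ?_ ?_ ?_
  · intro μ hμ
    have := (hC.eq_pow_of_pow_eq_one ((mem_nthRootsFinset (by omega : 0 < N) 1).1 hμ)).choose_spec
    simpa using this.1
  · intro j hj
    rw [mem_nthRootsFinset (by omega : 0 < N), ← pow_mul, mul_comm, pow_mul, hC.pow_eq_one, one_pow]
  · intro μ hμ
    exact (hC.eq_pow_of_pow_eq_one
      ((mem_nthRootsFinset (by omega : 0 < N) 1).1 hμ)).choose_spec.2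
  · intro j hj
    have hm : ((C w) ^ j) ^ N = 1 := by
      rw [← pow_mul, mul_comm, pow_mul, hC.pow_eq_one, one_pow]
    have := (hC.eq_pow_of_pow_eq_one hm).choose_spec
    exact hC.pow_inj this.1 (by simpa using hj) this.2
  · intro μ hμ
    have := (hC.eq_pow_of_pow_eq_one
      ((mem_nthRootsFinset (by omega : 0 < N) 1).1 hμ)).choose_spec
    rw [C_pow, this.2]
    ring

open Polynomial in
lemma powaux {E : Type*} [Ring E] [Algebra ℂ E] (R K : E) (w a : ℂ)
    (h : K * R = w • (R * K)) (n : ℕ) :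
    (R * (a • 1 + K)) ^ n =
      R ^ n * aeval K (∏ j ∈ Finset.range n, (C a + C (w ^ j) * (X : ℂ[X]))) := by
  have hK : ∀ n : ℕ, K * R ^ n = w ^ n • (R ^ n * K) := by
    intro n
    induction n with
    | zero => simp
    | succ n ih =>
      rw [pow_succ, ← mul_assoc, ih, smul_mul_assoc, mul_assoc, h, mul_smul_comm, smul_smul,
        ← pow_succ, ← mul_assoc]
  induction n with
  | zero => simp
  | succ n ih =>
    rw [pow_succ', ih, Finset.prod_range_succ, mul_comm (∏ j ∈ _, _), map_mul, ← mul_assoc,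
      ← mul_assoc]
    congr 1
    rw [mul_assoc, add_mul, hK]
    have e : aeval K (C a + C (w ^ n) * (X : ℂ[X])) = a • 1 + w ^ n • K := by
      simp [Algebra.smul_def]
    rw [e]
    simp only [pow_succ', mul_assoc, mul_add, smul_mul_assoc, mul_smul_comm, one_mul, mul_one]

lemma qbinom {E : Type*} [Ring E] [Algebra ℂ E] (N : ℕ) (hN : 1 ≤ N) (w : ℂ)
    (hw : IsPrimitiveRoot w N) (R S R' : E) (h1 : R * R' = 1) (h2 : R' * R = 1)
    (h : S * R = w • (R * S)) : (S + R) ^ N = S ^ N + R ^ N := by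
  have hRK : R * (R' * S) = S := by rw [← mul_assoc, h1, one_mul]
  have hK : (R' * S) * R = w • (R * (R' * S)) := by
    rw [hRK, mul_assoc, h, mul_smul_comm, ← mul_assoc, h2, one_mul]
  have e0 := powaux R (R' * S) w 0 hK N
  have e1 := powaux R (R' * S) w 1 hK N
  rw [prodformula N hN w hw] at e0 e1
  rw [mul_add] at e0 e1
  rw [hRK] at e0 e1
  have hN0 : N ≠ 0 := by omega
  simp [hN0] at e0 e1
  rw [add_comm S R, e1, e0, mul_sub]
  simp [sub_eq_add_neg, add_comm]

lemma opA_single (q : ℂ) (N : ℕ) (k : ZMod N) :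
    opA q N (Pi.single k 1) = q ^ (2 * k.val) • Pi.single k 1 := by
  funext j
  by_cases hj : j = k
  · subst hj; simp [opA]
  · simp [opA, hj]

lemma opB_single (N : ℕ) (k : ZMod N) :
    opB N (Pi.single k 1) = Pi.single (k + 1) 1 := by
  funext j
  by_cases hj : j = k + 1
  · subst hj; simp [opB]
  · have : j - 1 ≠ k := fun h => hj (by rw [← h]; ring)
    simp [opB, hj, this]

lemma pow_val_succ {E : Type*} [Monoid E] (N : ℕ) [NeZero N] (Z : E) (hZ : Z ^ N = 1)
    (k : ZMod N) : Z ^ (k + 1).val = Z * Z ^ k.val := by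
  rw [ZMod.val_add, ZMod.val_one_eq_one_mod, Nat.add_mod_mod, ← pow_eq_pow_mod _ hZ, pow_succ']

lemma opA_pow (q : ℂ) (N : ℕ) [NeZero N] (hq : (q ^ 2) ^ N = 1) : opA q N ^ N = 1 := by
  have h : ∀ n : ℕ, ∀ f k, (opA q N ^ n) f k = (q ^ (2 * k.val)) ^ n * f k := by
    intro n
    induction n with
    | zero => simp
    | succ n ih =>
      intro f k; rw [pow_succ', Module.End.mul_apply]
      change q ^ (2 * k.val) * (opA q N ^ n) f k = _
      rw [ih]; ring
  refine LinearMap.ext fun f => funext fun k => ?_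
  rw [h, pow_mul, ← pow_mul, mul_comm k.val N, pow_mul, hq]
  simp

lemma opB_pow (N : ℕ) [NeZero N] : opB N ^ N = 1 := by
  have h : ∀ n : ℕ, ∀ f k, (opB N ^ n) f k = f (k - n) := by
    intro n
    induction n with
    | zero => simp
    | succ n ih =>
      intro f k; rw [pow_succ', Module.End.mul_apply]
      simp only [opB, LinearMap.coe_mk, AddHom.coe_mk] at ih ⊢
      rw [ih]; congr 1; push_cast; ring
  refine LinearMap.ext fun f => funext fun k => ?_
  rw [h]; simp

lemma opAB (q : ℂ) (N : ℕ) [NeZero N] (hq : (q ^ 2) ^ N = 1) :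
    opA q N * opB N = q ^ 2 • (opB N * opA q N) := by
  refine (Pi.basisFun ℂ (ZMod N)).ext fun k => ?_
  simp only [Pi.basisFun_apply, Module.End.mul_apply, LinearMap.smul_apply, opA_single, opB_single,
    map_smul, smul_smul]
  rw [pow_mul, pow_val_succ N _ hq, pow_mul]

lemma main_lemma {W : Type*} [AddCommGroup W] [Module ℂ W] (N : ℕ) [NeZero N] (q : ℂ)
    (hq : IsPrimitiveRoot (q ^ 2) N) (a b : ℂ) (ha : a ≠ 0) (hb : b ≠ 0)
    (X Y : Module.End ℂ W) (hXY : X * Y = q ^ 2 • (Y * X))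
    (hX : X ^ N = a ^ N • 1) (hY : Y ^ N = b ^ N • 1)
    (CG : Submodule ℂ (CN N →ₗ[ℂ] W))
    (hCG : ∀ f, f ∈ CG ↔ f ∘ₗ (a • opA q N) = X ∘ₗ f ∧ f ∘ₗ (b • opB N) = Y ∘ₗ f) :
    Function.Bijective (TensorProduct.lift CG.subtype : CG ⊗[ℂ] CN N →ₗ[ℂ] W) := by
  set z := q ^ 2 with hz
  have hz0 : z ≠ 0 := hq.ne_zero (NeZero.ne N)
  set A : Module.End ℂ W := a⁻¹ • X with hA
  set Z : Module.End ℂ W := b⁻¹ • Y with hZ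
  have hXA : X = a • A := by rw [hA, smul_smul, mul_inv_cancel₀ ha, one_smul]
  have hYZ : Y = b • Z := by rw [hZ, smul_smul, mul_inv_cancel₀ hb, one_smul]
  have hAN : A ^ N = 1 := by
    rw [hA, smul_pow, hX, smul_smul, ← mul_pow, inv_mul_cancel₀ ha, one_pow, one_smul]
  have hZN : Z ^ N = 1 := by
    rw [hZ, smul_pow, hY, smul_smul, ← mul_pow, inv_mul_cancel₀ hb, one_pow, one_smul]
  have hAZ : A * Z = z • (Z * A) := by
    rw [hA, hZ, smul_mul_smul_comm, hXY, smul_mul_smul_comm, smul_smul, smul_smul]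
    congr 1; ring
  have hAZn : ∀ n : ℕ, A * Z ^ n = z ^ n • (Z ^ n * A) := by
    intro n
    induction n with
    | zero => simp
    | succ n ih =>
      rw [pow_succ, ← mul_assoc, ih, smul_mul_assoc, mul_assoc, hAZ, mul_smul_comm, smul_smul,
        ← pow_succ, ← mul_assoc]
  have hCG' : ∀ f, f ∈ CG ↔ ∀ k : ZMod N, A (f (Pi.single k 1)) = z ^ k.val • f (Pi.single k 1) ∧
      f (Pi.single (k + 1) 1) = Z (f (Pi.single k 1)) := by
    intro f
    rw [hCG, hXA, hYZ]
    constructor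
    · rintro ⟨h1, h2⟩ k
      have h1 := LinearMap.congr_fun h1 (Pi.single k 1)
      have h2 := LinearMap.congr_fun h2 (Pi.single k 1)
      simp only [LinearMap.comp_apply, LinearMap.smul_apply, opA_single, opB_single, map_smul,
        pow_mul] at h1 h2
      exact ⟨(smul_right_injective W ha h1).symm, smul_right_injective W hb h2⟩
    · intro h
      constructor <;> refine (Pi.basisFun ℂ (ZMod N)).ext fun k => ?_ <;>
      simp only [LinearMap.comp_apply, LinearMap.smul_apply, opA_single, opB_single, map_smul,
        pow_mul, Pi.basisFun_apply]
      · rw [(h k).1]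
      · rw [(h k).2]
  have hval : ∀ f ∈ CG, ∀ k : ZMod N, f (Pi.single k 1) = (Z ^ k.val) (f (Pi.single 0 1)) := by
    intro f hf k
    have : ∀ n : ℕ, f (Pi.single (n : ZMod N) 1) = (Z ^ n) (f (Pi.single 0 1)) := by
      intro n
      induction n with
      | zero => simp
      | succ n ih =>
        rw [Nat.cast_succ, (((hCG' f).1 hf) n).2, ih, pow_succ', Module.End.mul_apply]
    simpa using this k.val
  have hZinj : ∀ n : ℕ, ∀ w, (Z ^ n) w = 0 → w = 0 := by
    intro n w hw
    have : (Z ^ (n * (N - 1))) ((Z ^ n) w) = w := by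
      rw [← Module.End.mul_apply, ← pow_add]
      have : n * (N - 1) + n = N * n := by
        obtain ⟨m, hm⟩ : ∃ m, N = m + 1 := ⟨N - 1, by have := NeZero.pos N; omega⟩
        subst hm; simp; ring
      rw [this, pow_mul, hZN, one_pow]; rfl
    rw [← this, hw, map_zero]
  constructor
  · refine (injective_iff_map_eq_zero _).2 fun t ht => ?_
    obtain ⟨g, hg⟩ : ∃ g : ZMod N → CG, t = ∑ k, g k ⊗ₜ[ℂ] (Pi.single k 1 : CN N) := by
      clear ht
      induction t with
      | zero => exact ⟨0, by simp⟩
      | add x y hx hy =>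
        obtain ⟨g, rfl⟩ := hx
        obtain ⟨g', rfl⟩ := hy
        refine ⟨g + g', ?_⟩
        simp only [Pi.add_apply, TensorProduct.add_tmul, Finset.sum_add_distrib]
      | tmul f w =>
        refine ⟨fun k => w k • f, ?_⟩
        simp only [TensorProduct.smul_tmul]
        rw [← TensorProduct.tmul_sum]
        congr 1
        simpa using (pi_eq_sum_univ' w)
    rw [hg] at ht ⊢
    simp only [map_sum, TensorProduct.lift.tmul, Submodule.subtype_apply] at ht
    have hind := Module.End.eigenspaces_iSupIndep A
    have hpow : Function.Injective (fun k : ZMod N => z ^ k.val) := by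
      intro j k hjk
      exact ZMod.val_injective N (hq.pow_inj (ZMod.val_lt j) (ZMod.val_lt k) hjk)
    have hind2 := hind.comp hpow
    have hz : ∀ k, (g k : CN N →ₗ[ℂ] W) (Pi.single k 1) = 0 := by
      have h3 := (iSupIndep_iff_finsetSum_eq_zero_imp_eq_zero _).1 hind2 Finset.univ
        (fun k => (g k : CN N →ₗ[ℂ] W) (Pi.single k 1))
        (fun k _ => Module.End.mem_eigenspace_iff.2 ((hCG' _).1 (g k).2 k).1) ht
      exact fun k => h3 k (Finset.mem_univ k)
    refine Finset.sum_eq_zero fun k _ => ?_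
    have : g k = 0 := by
      apply Subtype.ext
      refine (Pi.basisFun ℂ (ZMod N)).ext fun j => ?_
      have h0 := hZinj k.val _ ((hval _ (g k).2 k).symm.trans (hz k))
      rw [Pi.basisFun_apply, hval _ (g k).2, h0]
      simp
    rw [this, TensorProduct.zero_tmul]
  · intro w
    have key : ∀ x : W, ∀ k : ZMod N, A x = z ^ k.val • x →
        x ∈ LinearMap.range (TensorProduct.lift CG.subtype : CG ⊗[ℂ] CN N →ₗ[ℂ] W) := by
      intro x k hx
      set y := (Z ^ (N - k.val)) x with hy
      have hAy : A y = y := by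
        rw [hy, ← Module.End.mul_apply, hAZn, LinearMap.smul_apply, Module.End.mul_apply, hx,
          map_smul, smul_smul, ← pow_add, Nat.sub_add_cancel (ZMod.val_lt k).le, hq.pow_eq_one,
          one_smul]
      set f : CN N →ₗ[ℂ] W := (Pi.basisFun ℂ (ZMod N)).constr ℂ (fun k => (Z ^ k.val) y) with hf
      have hfs : ∀ k, f (Pi.single k 1) = (Z ^ k.val) y := by
        intro k
        rw [← Pi.basisFun_apply, hf, Module.Basis.constr_basis]
      have hfm : f ∈ CG := by
        rw [hCG']
        intro k
        rw [hfs, hfs, pow_val_succ N Z hZN, Module.End.mul_apply, ← Module.End.mul_apply, hAZn,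
          LinearMap.smul_apply, Module.End.mul_apply, hAy]
        exact ⟨rfl, rfl⟩
      refine ⟨(⟨f, hfm⟩ : CG) ⊗ₜ Pi.single k 1, ?_⟩
      simp only [TensorProduct.lift.tmul, Submodule.subtype_apply, hfs]
      rw [hy, ← Module.End.mul_apply, ← pow_add, Nat.add_sub_cancel' (ZMod.val_lt k).le, hZN]
      rfl
    have hNC : (N : ℂ) ≠ 0 := by exact_mod_cast NeZero.ne N
    let P : ℕ → Module.End ℂ W := fun k => ∑ j ∈ Finset.range N, ((z⁻¹) ^ k • A) ^ j
    have hP : ∀ k, A * P k = z ^ k • P k := by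
      intro k
      have h1 : ((z⁻¹) ^ k • A) ^ N = 1 := by
        rw [smul_pow, hAN, ← pow_mul, mul_comm, pow_mul, inv_pow, hq.pow_eq_one]; simp
      have h2 := mul_geom_sum ((z⁻¹) ^ k • A) N
      rw [h1, sub_self, sub_mul, one_mul, sub_eq_zero, smul_mul_assoc] at h2
      change _ = z ^ k • ∑ j ∈ Finset.range N, ((z⁻¹) ^ k • A) ^ j
      rw [← h2, smul_smul, ← mul_pow, mul_inv_cancel₀ hz0, one_pow, one_smul]
    have hsum : ∑ k ∈ Finset.range N, P k = (N : ℂ) • 1 := by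
      simp only [P]
      rw [Finset.sum_comm, Finset.sum_eq_single 0]
      · simp [Nat.cast_smul_eq_nsmul]
      · intro j hj hj0
        simp only [smul_pow]
        rw [← Finset.sum_smul]
        have h3 : (z⁻¹) ^ j ≠ 1 := hq.inv.pow_ne_one_of_pos_of_lt hj0 (by simpa using hj)
        have h2 := mul_geom_sum ((z⁻¹) ^ j) N
        rw [← pow_mul, mul_comm j N, pow_mul, hq.inv.pow_eq_one, one_pow, sub_self] at h2
        have h4 := (mul_eq_zero.1 h2).resolve_left (sub_ne_zero.2 h3)
        have : ∑ i ∈ Finset.range N, (z⁻¹ ^ i) ^ j = 0 := by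
          rw [← h4]; exact Finset.sum_congr rfl fun i _ => pow_right_comm _ _ _
        rw [this, zero_smul]
      · intro h; exact absurd (Finset.mem_range.2 (NeZero.pos N)) h
    have hw : w = ∑ k ∈ Finset.range N, (N : ℂ)⁻¹ • P k w := by
      rw [← Finset.smul_sum, ← LinearMap.sum_apply, hsum]
      simp [smul_smul, hNC]
    rw [← LinearMap.mem_range, hw]
    refine Submodule.sum_mem _ fun k hk => Submodule.smul_mem _ _ (key _ (k : ZMod N) ?_)
    rw [← Module.End.mul_apply, hP, ZMod.val_natCast_of_lt (by simpa using hk)]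
    rfl

/-- for a regular pair (μ, ν) of standard Weyl pairs, the canonical
map Ω(μ,ν) : V_{(μ,ν)} ⊗ ℂ^N → ℂ^N ⊗ ℂ^N, f ⊗ w ↦ f(w), is a linear isomorphism. -/
theorem stmt8 (N : ℕ) (hN : 1 ≤ N) (q : ℂ) (hq : IsPrimitiveRoot (q ^ 2) N)
    (u v u' v' u'' v'' : ℂ) (hu : u ≠ 0) (hv : v ≠ 0) (hu' : u' ≠ 0) (hv' : v' ≠ 0)
    (hu'' : u'' ≠ 0) (hv'' : v'' ≠ 0)
    (hreg : (u ^ N)⁻¹ * v' ^ N + v ^ N ≠ 0)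
    (hx : u'' ^ N = u ^ N * u' ^ N) (hy : v'' ^ N = (u ^ N)⁻¹ * v' ^ N + v ^ N) :
    let CG := CGsub N (u • opA q N) (v • opB N) (u' • opA q N) (v' • opB N)
      (u'' • opA q N) (v'' • opB N)
    -- the canonical map Ω(μ,ν), sending f ⊗ w to f(w)
    let Ω : (CG ⊗[ℂ] CN N) →ₗ[ℂ] (CN N ⊗[ℂ] CN N) := TensorProduct.lift CG.subtype
    Function.Bijective Ω := by
  intro CG Ω
  have : NeZero N := ⟨by omega⟩
  have hq1 := hq.pow_eq_one
  have hAN := opA_pow q N hq1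
  have hBN := opB_pow N
  have hAB := opAB q N hq1
  set z := q ^ 2 with hz
  have hz0 : z ≠ 0 := hq.ne_zero (NeZero.ne N)
  have hNs : N - 1 + 1 = N := by omega
  set I := Ring.inverse (u • opA q N) with hI
  have hIu : IsUnit (u • opA q N) := by
    refine ⟨⟨u • opA q N, u⁻¹ • opA q N ^ (N - 1), ?_, ?_⟩, rfl⟩
    · rw [smul_mul_smul_comm, ← pow_succ', hNs, hAN, mul_inv_cancel₀ hu, one_smul]
    · rw [smul_mul_smul_comm, ← pow_succ, hNs, hAN, inv_mul_cancel₀ hu, one_smul]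
  have hI1 : (u • opA q N) * I = 1 := Ring.mul_inverse_cancel _ hIu
  have hI2 : I * (u • opA q N) = 1 := Ring.inverse_mul_cancel _ hIu
  have hcomm : Commute I (u • opA q N) := hI2.trans hI1.symm
  have hIN : I ^ N = (u ^ N)⁻¹ • 1 := by
    have h1 : I ^ N * (u • opA q N) ^ N = 1 := by rw [← hcomm.mul_pow, hI2, one_pow]
    rw [smul_pow, hAN, mul_smul_comm, mul_one] at h1
    rw [← h1, smul_smul, inv_mul_cancel₀ (pow_ne_zero _ hu), one_smul]
  have hAB' : (u • opA q N) * opB N = z • (opB N * (u • opA q N)) := by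
    rw [smul_mul_assoc, hAB, mul_smul_comm, smul_comm]
  have hIB : I * opB N = z⁻¹ • (opB N * I) := by
    have h1 : opB N * I = z • (I * opB N) := by
      calc opB N * I = I * ((u • opA q N) * opB N) * I := by
            rw [← mul_assoc I, hI2, one_mul]
        _ = z • (I * opB N * ((u • opA q N) * I)) := by
            rw [hAB', mul_smul_comm, smul_mul_assoc, mul_assoc, mul_assoc, mul_assoc]
        _ = _ := by rw [hI1, mul_one]
    rw [h1, smul_smul, inv_mul_cancel₀ hz0, one_smul]
  refine main_lemma N q hq u'' v'' hu'' hv'' (TensorProduct.map (u • opA q N) (u' • opA q N))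
    (TensorProduct.map I (v' • opB N) + TensorProduct.map (v • opB N) 1) ?_ ?_ ?_ CG
    (fun f => Iff.rfl)
  · rw [mul_add, add_mul, ← TensorProduct.map_mul, ← TensorProduct.map_mul,
      ← TensorProduct.map_mul, ← TensorProduct.map_mul, hI1, hI2, mul_one, one_mul,
      smul_mul_smul_comm u', hAB, smul_mul_smul_comm v', mul_smul_comm v, hAB', smul_mul_assoc v,
      smul_add]
    simp only [TensorProduct.map_smul_right, TensorProduct.map_smul_left, smul_smul]
    congr 2 <;> ring
  · rw [TensorProduct.map_pow, smul_pow, smul_pow, hAN, TensorProduct.map_smul_left,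
      TensorProduct.map_smul_right, TensorProduct.map_one, smul_smul, hx]
  · refine (qbinom (E := Module.End ℂ (CN N ⊗[ℂ] CN N)) N hN z⁻¹ hq.inv
      (TensorProduct.map (v • opB N) 1) (TensorProduct.map I (v' • opB N))
      (TensorProduct.map (v⁻¹ • opB N ^ (N - 1)) 1) ?_ ?_ ?_).trans ?_
    rotate_right
    · rw [TensorProduct.map_pow, TensorProduct.map_pow, smul_pow, smul_pow, hBN, hIN, one_pow]
      simp only [TensorProduct.map_smul_right, TensorProduct.map_smul_left, smul_smul,
        TensorProduct.map_one]
      rw [← add_smul, hy, mul_comm]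
    · rw [← TensorProduct.map_mul, smul_mul_smul_comm, ← pow_succ', hNs, hBN, mul_inv_cancel₀ hv,
        one_smul, one_mul, TensorProduct.map_one]
    · rw [← TensorProduct.map_mul, smul_mul_smul_comm, ← pow_succ, hNs, hBN, inv_mul_cancel₀ hv,
        one_smul, one_mul, TensorProduct.map_one]
    · rw [← TensorProduct.map_mul, ← TensorProduct.map_mul, mul_smul_comm, hIB, smul_mul_assoc v,
        mul_one, one_mul]
      simp only [TensorProduct.map_smul_right, TensorProduct.map_smul_left, smul_smul]
      congr 1; ring

end
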